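/- Suppose A₀ and A₁ are jointly positive definite, i.e., there exists μ₁ ∈ ℝ such that A₀ + μ₁A₁ is positive definite. Then: (i) if A₁ is positive semidefinite or negative semidefinite, the problem (GTR) has at most one local-nonglobal minimizer; (ii) if A₁ is indefinite (there exist x̄, x̃ with x̄ᵀA₁x̄ < 0 < x̃ᵀA₁x̃), the problem (GTR) has at most two local-nonglobal minimizers. -/

import Mathlib

open Matrix Finset

/-- Euclidean norm of a vector in `Fin n → ℝ`. -/
noncomputable def euclNorm {n : ℕ} (x : Fin n → ℝ) : ℝ := Real.sqrt (x ⬝ᵥ x)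

/-- Objective `f₀(x) = xᵀA₀x + 2b₀ᵀx`. -/
noncomputable def qf0 {n : ℕ} (A0 : Matrix (Fin n) (Fin n) ℝ) (b0 : Fin n → ℝ)
    (x : Fin n → ℝ) : ℝ := x ⬝ᵥ A0.mulVec x + 2 * (b0 ⬝ᵥ x)

/-- Constraint `f₁(x) = xᵀA₁x + 2b₁ᵀx + c₁`. -/
noncomputable def qf1 {n : ℕ} (A1 : Matrix (Fin n) (Fin n) ℝ) (b1 : Fin n → ℝ) (c1 : ℝ)
    (x : Fin n → ℝ) : ℝ := x ⬝ᵥ A1.mulVec x + 2 * (b1 ⬝ᵥ x) + c1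

/-- Local minimizer of (GTRE): feasible, and locally optimal among feasible points. -/
def IsLocalMinGTRE {n : ℕ} (A0 A1 : Matrix (Fin n) (Fin n) ℝ) (b0 b1 : Fin n → ℝ) (c1 : ℝ)
    (xs : Fin n → ℝ) : Prop :=
  qf1 A1 b1 c1 xs = 0 ∧ ∃ δ > (0:ℝ), ∀ x : Fin n → ℝ,
    qf1 A1 b1 c1 x = 0 → euclNorm (x - xs) < δ → qf0 A0 b0 xs ≤ qf0 A0 b0 x

/-- Global minimizer of (GTRE). -/
def IsGlobalMinGTRE {n : ℕ} (A0 A1 : Matrix (Fin n) (Fin n) ℝ) (b0 b1 : Fin n → ℝ) (c1 : ℝ)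
    (xs : Fin n → ℝ) : Prop :=
  qf1 A1 b1 c1 xs = 0 ∧ ∀ x : Fin n → ℝ, qf1 A1 b1 c1 x = 0 → qf0 A0 b0 xs ≤ qf0 A0 b0 x

/-- Local-nonglobal minimizer of (GTRE). -/
def IsLNGMinGTRE {n : ℕ} (A0 A1 : Matrix (Fin n) (Fin n) ℝ) (b0 b1 : Fin n → ℝ) (c1 : ℝ)
    (xs : Fin n → ℝ) : Prop :=
  IsLocalMinGTRE A0 A1 b0 b1 c1 xs ∧ ¬ IsGlobalMinGTRE A0 A1 b0 b1 c1 xs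

/-- Strict local minimizer of (GTRE). -/
def IsStrictLocalMinGTRE {n : ℕ} (A0 A1 : Matrix (Fin n) (Fin n) ℝ) (b0 b1 : Fin n → ℝ)
    (c1 : ℝ) (xs : Fin n → ℝ) : Prop :=
  qf1 A1 b1 c1 xs = 0 ∧ ∃ δ > (0:ℝ), ∀ x : Fin n → ℝ,
    qf1 A1 b1 c1 x = 0 → x ≠ xs → euclNorm (x - xs) < δ → qf0 A0 b0 xs < qf0 A0 b0 x

/-- Strict local-nonglobal minimizer of (GTRE). -/
def IsStrictLNGMinGTRE {n : ℕ} (A0 A1 : Matrix (Fin n) (Fin n) ℝ) (b0 b1 : Fin n → ℝ)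
    (c1 : ℝ) (xs : Fin n → ℝ) : Prop :=
  IsStrictLocalMinGTRE A0 A1 b0 b1 c1 xs ∧ ¬ IsGlobalMinGTRE A0 A1 b0 b1 c1 xs

/-- Local minimizer of (GTR). -/
def IsLocalMinGTR {n : ℕ} (A0 A1 : Matrix (Fin n) (Fin n) ℝ) (b0 b1 : Fin n → ℝ) (c1 : ℝ)
    (xs : Fin n → ℝ) : Prop :=
  qf1 A1 b1 c1 xs ≤ 0 ∧ ∃ δ > (0:ℝ), ∀ x : Fin n → ℝ,
    qf1 A1 b1 c1 x ≤ 0 → euclNorm (x - xs) < δ → qf0 A0 b0 xs ≤ qf0 A0 b0 x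

/-- Global minimizer of (GTR). -/
def IsGlobalMinGTR {n : ℕ} (A0 A1 : Matrix (Fin n) (Fin n) ℝ) (b0 b1 : Fin n → ℝ) (c1 : ℝ)
    (xs : Fin n → ℝ) : Prop :=
  qf1 A1 b1 c1 xs ≤ 0 ∧ ∀ x : Fin n → ℝ, qf1 A1 b1 c1 x ≤ 0 → qf0 A0 b0 xs ≤ qf0 A0 b0 x

/-- Local-nonglobal minimizer of (GTR). -/
def IsLNGMinGTR {n : ℕ} (A0 A1 : Matrix (Fin n) (Fin n) ℝ) (b0 b1 : Fin n → ℝ) (c1 : ℝ)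
    (xs : Fin n → ℝ) : Prop :=
  IsLocalMinGTR A0 A1 b0 b1 c1 xs ∧ ¬ IsGlobalMinGTR A0 A1 b0 b1 c1 xs

/-- Strict local minimizer of (GTR). -/
def IsStrictLocalMinGTR {n : ℕ} (A0 A1 : Matrix (Fin n) (Fin n) ℝ) (b0 b1 : Fin n → ℝ)
    (c1 : ℝ) (xs : Fin n → ℝ) : Prop :=
  qf1 A1 b1 c1 xs ≤ 0 ∧ ∃ δ > (0:ℝ), ∀ x : Fin n → ℝ,
    qf1 A1 b1 c1 x ≤ 0 → x ≠ xs → euclNorm (x - xs) < δ → qf0 A0 b0 xs < qf0 A0 b0 x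

/-- Strict local-nonglobal minimizer of (GTR). -/
def IsStrictLNGMinGTR {n : ℕ} (A0 A1 : Matrix (Fin n) (Fin n) ℝ) (b0 b1 : Fin n → ℝ)
    (c1 : ℝ) (xs : Fin n → ℝ) : Prop :=
  IsStrictLocalMinGTR A0 A1 b0 b1 c1 xs ∧ ¬ IsGlobalMinGTR A0 A1 b0 b1 c1 xs

open Filter Topology in
/-- A quadratic polynomial that is nonnegative for all small positive `t` has nonnegative constant
term. -/
lemma const_nonneg_of_eventually_nonneg {a b c : ℝ}
    (h : ∀ᶠ t in 𝓝[>] (0 : ℝ), 0 ≤ a + b * t + c * t ^ 2) : 0 ≤ a := by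
  have hc : Tendsto (fun t : ℝ => a + b * t + c * t ^ 2) (𝓝[>] 0) (𝓝 a) := by
    have : ContinuousAt (fun t : ℝ => a + b * t + c * t ^ 2) 0 := by fun_prop
    simpa using this.tendsto.mono_left nhdsWithin_le_nhds
  exact ge_of_tendsto hc h

section QuadraticForms

variable {n : ℕ} {A A0 A1 : Matrix (Fin n) (Fin n) ℝ} {b0 b1 x y : Fin n → ℝ} {c1 l m μ : ℝ}

lemma Matrix.IsSymm.dotProduct_mulVec_comm (hA : A.IsSymm) (u v : Fin n → ℝ) :
    u ⬝ᵥ A *ᵥ v = v ⬝ᵥ A *ᵥ u := by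
  rw [dotProduct_mulVec, ← mulVec_transpose, hA.eq, dotProduct_comm]

lemma qf0_add (hA : A0.IsSymm) (x d : Fin n → ℝ) :
    qf0 A0 b0 (x + d) =
      qf0 A0 b0 x + 2 * ((A0 *ᵥ x + b0) ⬝ᵥ d) + d ⬝ᵥ A0 *ᵥ d := by
  simp only [qf0, mulVec_add, add_dotProduct, dotProduct_add]
  rw [hA.dotProduct_mulVec_comm x d, dotProduct_comm (A0 *ᵥ x) d]
  ring

lemma qf1_add (hA : A1.IsSymm) (x d : Fin n → ℝ) :
    qf1 A1 b1 c1 (x + d) =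
      qf1 A1 b1 c1 x + 2 * ((A1 *ᵥ x + b1) ⬝ᵥ d) + d ⬝ᵥ A1 *ᵥ d := by
  simp only [qf1, mulVec_add, add_dotProduct, dotProduct_add]
  rw [hA.dotProduct_mulVec_comm x d, dotProduct_comm (A1 *ᵥ x) d]
  ring

open Filter Topology in
/-- Local optimality along a continuous curve through the minimizer. -/
lemma IsLocalMinGTR.eventually_le (h : IsLocalMinGTR A0 A1 b0 b1 c1 x) {γ : ℝ → Fin n → ℝ}
    (hγ : Continuous γ) (h0 : γ 0 = 0) :
    ∀ᶠ t in 𝓝[>] (0 : ℝ), qf1 A1 b1 c1 (x + γ t) ≤ 0 →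
      qf0 A0 b0 x ≤ qf0 A0 b0 (x + γ t) := by
  obtain ⟨-, δ, hδ, hmin⟩ := h
  have hcont : Continuous fun t => euclNorm (γ t) := by
    unfold euclNorm
    fun_prop
  have hev : ∀ᶠ t in 𝓝 (0 : ℝ), euclNorm (γ t) < δ := by
    refine hcont.continuousAt.eventually_lt continuousAt_const ?_
    simpa [h0, euclNorm] using hδ
  filter_upwards [hev.filter_mono nhdsWithin_le_nhds] with t ht hf
  exact hmin _ hf (by simpa using ht)

open Filter Topology in
/-- If the segment from a local minimizer in direction `d` is initially feasible, then `d` is not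
a descent direction. -/
lemma IsLocalMinGTR.gradient_nonneg (h : IsLocalMinGTR A0 A1 b0 b1 c1 x) (hA0 : A0.IsSymm)
    {d : Fin n → ℝ} (hd : ∀ᶠ t in 𝓝[>] (0 : ℝ), qf1 A1 b1 c1 (x + t • d) ≤ 0) :
    0 ≤ (A0 *ᵥ x + b0) ⬝ᵥ d := by
  have hev := h.eventually_le (γ := fun t => t • d) (by fun_prop) (by simp)
  have key : 0 ≤ 2 * ((A0 *ᵥ x + b0) ⬝ᵥ d) := by
    refine const_nonneg_of_eventually_nonneg (b := d ⬝ᵥ A0 *ᵥ d) (c := 0) ?_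
    filter_upwards [hev, hd, self_mem_nhdsWithin] with t h1 h2 (ht : 0 < t)
    have h3 := h1 h2
    rw [qf0_add hA0] at h3
    simp only [mulVec_smul, dotProduct_smul, smul_dotProduct, smul_eq_mul] at h3
    refine nonneg_of_mul_nonneg_right (a := t) ?_ ht
    linarith
  linarith

open Filter Topology in
/-- If the line through a local minimizer in direction `d` is feasible near the minimizer, then
the objective is globally minimal along that line. -/
lemma IsLocalMinGTR.le_of_eventually_feasible (h : IsLocalMinGTR A0 A1 b0 b1 c1 x)
    (hA0 : A0.IsSymm) {d : Fin n → ℝ}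
    (hd : ∀ᶠ t in 𝓝[>] (0 : ℝ), qf1 A1 b1 c1 (x + t • d) ≤ 0)
    (hd' : ∀ᶠ t in 𝓝[>] (0 : ℝ), qf1 A1 b1 c1 (x + t • -d) ≤ 0) :
    qf0 A0 b0 x ≤ qf0 A0 b0 (x + d) := by
  have h1 := h.gradient_nonneg hA0 hd
  have h2 := h.gradient_nonneg hA0 hd'
  rw [dotProduct_neg] at h2
  have h0 : (A0 *ᵥ x + b0) ⬝ᵥ d = 0 := by linarith
  have hev := h.eventually_le (γ := fun t => t • d) (by fun_prop) (by simp)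
  have hq : 0 ≤ d ⬝ᵥ A0 *ᵥ d := by
    obtain ⟨t, ⟨h3, h4⟩, ht : 0 < t⟩ := ((hev.and hd).and self_mem_nhdsWithin).exists
    have h5 := h3 h4
    rw [qf0_add hA0] at h5
    simp only [mulVec_smul, dotProduct_smul, smul_dotProduct, smul_eq_mul, h0] at h5
    refine nonneg_of_mul_nonneg_right (a := t * t) ?_ (by positivity)
    linarith
  rw [qf0_add hA0, h0]
  linarith

open Filter Topology in
lemma eventually_feasible_of_gradient_neg (hA1 : A1.IsSymm) (hx : qf1 A1 b1 c1 x = 0)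
    {d : Fin n → ℝ} (hd : (A1 *ᵥ x + b1) ⬝ᵥ d < 0) :
    ∀ᶠ t in 𝓝[>] (0 : ℝ), qf1 A1 b1 c1 (x + t • d) ≤ 0 := by
  have hc : ContinuousAt (fun t : ℝ => 2 * ((A1 *ᵥ x + b1) ⬝ᵥ d) + t * (d ⬝ᵥ A1 *ᵥ d)) 0 := by
    fun_prop
  have hev := hc.eventually_lt (continuousAt_const (y := (0 : ℝ)))
    (by rw [zero_mul, add_zero]; linarith)
  filter_upwards [hev.filter_mono nhdsWithin_le_nhds, self_mem_nhdsWithin] with t h1 (ht : 0 < t)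
  rw [qf1_add hA1, hx]
  simp only [mulVec_smul, dotProduct_smul, smul_dotProduct, smul_eq_mul]
  nlinarith

/-- `l` is a multiplier at the regular point `x` for which the second order necessary condition
holds, although the Hessian of the Lagrangian is not positive semidefinite. -/
structure IsIndefiniteMultiplier (A0 A1 : Matrix (Fin n) (Fin n) ℝ) (b0 b1 x : Fin n → ℝ)
    (l : ℝ) : Prop where
  stationary : A0 *ᵥ x + b0 + l • (A1 *ᵥ x + b1) = 0
  regular : A1 *ᵥ x + b1 ≠ 0
  curvature : ∀ d, (A1 *ᵥ x + b1) ⬝ᵥ d = 0 → 0 ≤ d ⬝ᵥ (A0 + l • A1) *ᵥ d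
  exists_neg : ∃ v, v ⬝ᵥ (A0 + l • A1) *ᵥ v < 0

lemma IsIndefiniteMultiplier.neg (h : IsIndefiniteMultiplier A0 A1 b0 b1 x l) :
    IsIndefiniteMultiplier A0 (-A1) b0 (-b1) x (-l) where
  stationary := by
    rw [← h.stationary]
    simp only [neg_mulVec, smul_add, smul_neg, neg_smul, neg_neg]
  regular := by
    rw [neg_mulVec, ← neg_add]
    exact neg_ne_zero.mpr h.regular
  curvature d hd := by
    rw [neg_mulVec, ← neg_add, neg_dotProduct, neg_eq_zero] at hd
    simpa using h.curvature d hd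
  exists_neg := by simpa using h.exists_neg

open Filter Topology in
/-- The second order necessary condition at a regular local minimizer. -/
lemma IsLocalMinGTR.curvature_nonneg (h : IsLocalMinGTR A0 A1 b0 b1 c1 x) (hA0 : A0.IsSymm)
    (hA1 : A1.IsSymm) (hx : qf1 A1 b1 c1 x = 0) (hg : A1 *ᵥ x + b1 ≠ 0)
    (hl : A0 *ᵥ x + b0 + l • (A1 *ᵥ x + b1) = 0) {d : Fin n → ℝ}
    (hd : (A1 *ᵥ x + b1) ⬝ᵥ d = 0) : 0 ≤ d ⬝ᵥ (A0 + l • A1) *ᵥ d := by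
  set g := A1 *ᵥ x + b1 with hgdef
  have hgg : 0 < g ⬝ᵥ g := by
    simpa using (Matrix.dotProduct_star_self_pos_iff (v := g)).mpr hg
  have hg0 : A0 *ᵥ x + b0 = -(l • g) := eq_neg_of_add_eq_zero_left hl
  have key : ∀ ε > 0, 0 ≤ d ⬝ᵥ (A0 + l • A1) *ᵥ d + l * ε := by
    intro ε hε
    obtain ⟨c, hc⟩ : ∃ c : ℝ, 2 * c * (g ⬝ᵥ g) = d ⬝ᵥ A1 *ᵥ d + ε :=
      ⟨(d ⬝ᵥ A1 *ᵥ d + ε) / (2 * (g ⬝ᵥ g)), by field_simp⟩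
    have hev := h.eventually_le (γ := fun t => t • d + (-(t ^ 2 * c)) • g) (by fun_prop) (by simp)
    have hf1 : ∀ t : ℝ, qf1 A1 b1 c1 (x + (t • d + (-(t ^ 2 * c)) • g)) =
        t ^ 2 * (-ε + t * (-(2 * c * (d ⬝ᵥ A1 *ᵥ g)) + t * (c ^ 2 * (g ⬝ᵥ A1 *ᵥ g)))) := by
      intro t
      rw [qf1_add hA1, hx, ← hgdef]
      simp only [mulVec_smul, mulVec_add, dotProduct_add, add_dotProduct, dotProduct_smul,
        smul_dotProduct, smul_eq_mul, hd, hA1.dotProduct_mulVec_comm g d]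
      linear_combination -t ^ 2 * hc
    have hfeas : ∀ᶠ t in 𝓝 (0 : ℝ),
        -ε + t * (-(2 * c * (d ⬝ᵥ A1 *ᵥ g)) + t * (c ^ 2 * (g ⬝ᵥ A1 *ᵥ g))) < 0 := by
      refine ContinuousAt.eventually_lt (f := fun t : ℝ =>
        -ε + t * (-(2 * c * (d ⬝ᵥ A1 *ᵥ g)) + t * (c ^ 2 * (g ⬝ᵥ A1 *ᵥ g))))
        (by fun_prop) continuousAt_const ?_
      simpa using hε
    refine const_nonneg_of_eventually_nonneg (b := -(2 * c * (d ⬝ᵥ (A0 + l • A1) *ᵥ g)) +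
      l * (2 * c * (d ⬝ᵥ A1 *ᵥ g))) (c := c ^ 2 * (g ⬝ᵥ A0 *ᵥ g)) ?_
    filter_upwards [hev, hfeas.filter_mono nhdsWithin_le_nhds, self_mem_nhdsWithin]
      with t h1 h2 (ht : 0 < t)
    have h3 := h1 (by rw [hf1]; exact mul_nonpos_of_nonneg_of_nonpos (by positivity) h2.le)
    rw [qf0_add hA0, hg0] at h3
    refine nonneg_of_mul_nonneg_right (a := t ^ 2) ?_ (by positivity)
    simp only [mulVec_smul, mulVec_add, dotProduct_add, add_dotProduct, dotProduct_smul,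
      smul_dotProduct, neg_dotProduct, smul_eq_mul, hd, add_mulVec, smul_mulVec,
      hA0.dotProduct_mulVec_comm g d] at h3 ⊢
    linear_combination h3 + l * t ^ 2 * hc
  by_contra! hneg
  by_cases hl0 : 0 < l
  · have := key (-(d ⬝ᵥ (A0 + l • A1) *ᵥ d) / (2 * l)) (by
      apply div_pos <;> linarith)
    have h2 : l * (-(d ⬝ᵥ (A0 + l • A1) *ᵥ d) / (2 * l)) =
      -(d ⬝ᵥ (A0 + l • A1) *ᵥ d) / 2 := by field_simp
    linarith
  · have := key 1 one_pos
    linarith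

open Filter Topology in
/-- The first order necessary condition at a regular local minimizer. -/
lemma IsLocalMinGTR.exists_multiplier (h : IsLocalMinGTR A0 A1 b0 b1 c1 x) (hA0 : A0.IsSymm)
    (hA1 : A1.IsSymm) (hx : qf1 A1 b1 c1 x = 0) (hg : A1 *ᵥ x + b1 ≠ 0) :
    ∃ l : ℝ, 0 ≤ l ∧ A0 *ᵥ x + b0 + l • (A1 *ᵥ x + b1) = 0 := by
  have hfirst : ∀ d, (A1 *ᵥ x + b1) ⬝ᵥ d < 0 → 0 ≤ (A0 *ᵥ x + b0) ⬝ᵥ d := fun d hd =>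
    h.gradient_nonneg hA0 (eventually_feasible_of_gradient_neg hA1 hx hd)
  generalize A0 *ᵥ x + b0 = g0 at *
  generalize A1 *ᵥ x + b1 = g at *
  have hgg : 0 < g ⬝ᵥ g := by
    simpa using (Matrix.dotProduct_star_self_pos_iff (v := g)).mpr hg
  obtain ⟨l, hl⟩ : ∃ l : ℝ, l * (g ⬝ᵥ g) = -(g0 ⬝ᵥ g) := ⟨-(g0 ⬝ᵥ g) / (g ⬝ᵥ g), by field_simp⟩
  refine ⟨l, ?_, ?_⟩
  · have := hfirst (-g) (by simpa using hgg)
    rw [dotProduct_neg, ← hl] at this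
    exact nonneg_of_mul_nonneg_left this hgg
  · set w := g0 + l • g with hw
    have hgw : g ⬝ᵥ w = 0 := by
      rw [hw, dotProduct_add, dotProduct_smul, smul_eq_mul, dotProduct_comm g g0]
      linarith
    have hg0 : g0 = w - l • g := by rw [hw]; abel
    have key : 0 ≤ -(w ⬝ᵥ w) := by
      refine const_nonneg_of_eventually_nonneg (b := l * (g ⬝ᵥ g)) (c := 0) ?_
      filter_upwards [self_mem_nhdsWithin] with t (ht : 0 < t)
      have := hfirst (-w - t • g) (by
        rw [dotProduct_sub, dotProduct_neg, hgw, dotProduct_smul, smul_eq_mul]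
        nlinarith)
      rw [hg0] at this
      simp only [sub_dotProduct, dotProduct_sub, dotProduct_neg, dotProduct_smul, smul_dotProduct,
        smul_eq_mul, hgw, dotProduct_comm w g] at this
      linarith
    by_contra hne
    have : 0 < w ⬝ᵥ w := by
      simpa using (Matrix.dotProduct_star_self_pos_iff (v := w)).mpr hne
    linarith

open Filter Topology in
/-- A local-nonglobal minimizer lies on the boundary and has an indefinite multiplier. -/
lemma IsLNGMinGTR.exists_isIndefiniteMultiplier (h : IsLNGMinGTR A0 A1 b0 b1 c1 x)
    (hA0 : A0.IsSymm) (hA1 : A1.IsSymm) :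
    qf1 A1 b1 c1 x = 0 ∧ ∃ l, IsIndefiniteMultiplier A0 A1 b0 b1 x l := by
  obtain ⟨hloc, hng⟩ := h
  have hfx := hloc.1
  have hx : qf1 A1 b1 c1 x = 0 := by
    by_contra hne
    have hlt : qf1 A1 b1 c1 x < 0 := lt_of_le_of_ne hfx hne
    have hdir : ∀ d : Fin n → ℝ, ∀ᶠ t in 𝓝[>] (0 : ℝ), qf1 A1 b1 c1 (x + t • d) ≤ 0 := by
      intro d
      have hc : Continuous fun t : ℝ => qf1 A1 b1 c1 (x + t • d) := by
        unfold qf1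
        fun_prop
      have hev := hc.continuousAt.eventually_lt (x₀ := 0) (continuousAt_const (y := (0 : ℝ)))
        (by simpa using hlt)
      exact (hev.filter_mono nhdsWithin_le_nhds).mono fun _ => le_of_lt
    refine hng ⟨hfx, fun z _ => ?_⟩
    have := hloc.le_of_eventually_feasible hA0 (hdir (z - x)) (hdir (-(z - x)))
    rwa [add_sub_cancel] at this
  have hg : A1 *ᵥ x + b1 ≠ 0 := by
    intro hg
    refine hng ⟨hfx, fun z hz => ?_⟩
    have hq := qf1_add (b1 := b1) (c1 := c1) hA1 x (z - x)
    rw [add_sub_cancel, hx, hg, zero_dotProduct] at hq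
    have hdir : ∀ t : ℝ, qf1 A1 b1 c1 (x + t • (z - x)) ≤ 0 := by
      intro t
      rw [qf1_add hA1, hx, hg, zero_dotProduct, mulVec_smul, dotProduct_smul, smul_dotProduct,
        smul_eq_mul, smul_eq_mul]
      nlinarith [mul_self_nonneg t]
    have := hloc.le_of_eventually_feasible hA0 (d := z - x) (.of_forall hdir)
      (.of_forall fun t => by simpa only [smul_neg, neg_smul] using hdir (-t))
    rwa [add_sub_cancel] at this
  obtain ⟨l, hl0, hl⟩ := hloc.exists_multiplier hA0 hA1 hx hg
  refine ⟨hx, l, hl, hg, fun d hd => hloc.curvature_nonneg hA0 hA1 hx hg hl hd, ?_⟩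
  by_contra! hpsd
  refine hng ⟨hfx, fun z hz => ?_⟩
  have hq0 := qf0_add (b0 := b0) hA0 x (z - x)
  have hq1 := qf1_add (b1 := b1) (c1 := c1) hA1 x (z - x)
  rw [add_sub_cancel] at hq0 hq1
  have hp := hpsd (z - x)
  have hs := congrArg (· ⬝ᵥ (z - x)) hl
  simp only [add_dotProduct _ _ (z - x), smul_dotProduct, zero_dotProduct, smul_eq_mul] at hs
  simp only [add_dotProduct _ _ (z - x)] at hq0 hq1
  simp only [add_mulVec, smul_mulVec, dotProduct_add, dotProduct_smul, smul_eq_mul] at hp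
  have hm : l * qf1 A1 b1 c1 z ≤ 0 := mul_nonpos_of_nonneg_of_nonpos hl0 hz
  rw [hq1, hx] at hm
  linarith

/-- Two symmetric forms `P`, `R` taking opposite values at `d` and each nonnegative on the
orthogonal complement of `d` with respect to the other one: if some `R + k (R - P)` with `k ≥ 0`
is nonnegative, then so is `R`. -/
lemma nonneg_of_nonneg_on_conjugate_hyperplanes {P R : Matrix (Fin n) (Fin n) ℝ}
    (hP : P.IsSymm) (hR : R.IsSymm) {d : Fin n → ℝ} {p k : ℝ} (hp : 0 < p) (hk : 0 ≤ k)
    (hRd : d ⬝ᵥ R *ᵥ d = p) (hPd : d ⬝ᵥ P *ᵥ d = -p)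
    (hPnn : ∀ w, w ⬝ᵥ R *ᵥ d = 0 → 0 ≤ w ⬝ᵥ P *ᵥ w)
    (hRnn : ∀ w, w ⬝ᵥ P *ᵥ d = 0 → 0 ≤ w ⬝ᵥ R *ᵥ w)
    (hnn : ∀ w, 0 ≤ (1 + k) * (w ⬝ᵥ R *ᵥ w) - k * (w ⬝ᵥ P *ᵥ w)) (v : Fin n → ℝ) :
    0 ≤ v ⬝ᵥ R *ᵥ v := by
  by_contra! hv
  obtain ⟨t, ht⟩ : ∃ t : ℝ, t * p = v ⬝ᵥ P *ᵥ d := ⟨v ⬝ᵥ P *ᵥ d / p, by field_simp⟩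
  obtain ⟨u, rfl⟩ : ∃ u, v = u - t • d := ⟨v + t • d, by simp⟩
  have hud : u ⬝ᵥ P *ᵥ d = 0 := by
    simp only [sub_dotProduct, smul_dotProduct, smul_eq_mul, hPd] at ht
    linarith
  have hdu : d ⬝ᵥ P *ᵥ u = 0 := by rw [hP.dotProduct_mulVec_comm, hud]
  have hr := hRnn u hud
  have hsym := hR.dotProduct_mulVec_comm u d
  have hw := hPnn ((d ⬝ᵥ R *ᵥ u) • d - p • u) (by
    simp only [sub_dotProduct, smul_dotProduct, smul_eq_mul, hRd, hsym]
    ring)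
  have hz := hnn (((1 + k) * (d ⬝ᵥ R *ᵥ u)) • d - (p * (1 + 2 * k)) • u)
  simp only [sub_dotProduct, mulVec_sub, dotProduct_sub, mulVec_smul, smul_dotProduct,
    dotProduct_smul, smul_eq_mul, hRd, hPd, hud, hdu, hsym] at hv hw hz
  generalize d ⬝ᵥ R *ᵥ u = q at *
  generalize u ⬝ᵥ R *ᵥ u = r at *
  generalize u ⬝ᵥ P *ᵥ u = s at *
  have hq : p * r < q ^ 2 := by nlinarith [sq_nonneg (t * p - q)]
  have hqs : q ^ 2 ≤ p * s := by
    refine le_of_mul_le_mul_left (a := p) ?_ hp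
    linarith
  have hrs : p * r < p * s := hq.trans_le hqs
  have hdet : 0 ≤ (1 + 2 * k) * (p * r + k * (p * r - p * s)) - (1 + k) ^ 2 * q ^ 2 := by
    refine nonneg_of_mul_nonneg_right (a := p * (1 + 2 * k)) ?_ (by positivity)
    linarith
  have h1 : 0 ≤ (1 + 2 * k) * (k * (p * s - p * r)) :=
    mul_nonneg (by positivity) (mul_nonneg hk (by linarith))
  have h2 : 0 < (1 + k) ^ 2 * (q ^ 2 - p * r) := mul_pos (by positivity) (by linarith)
  have h3 : 0 ≤ k ^ 2 * (p * r) := by positivity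
  linarith

/-- Boundary points with indefinite multipliers below a multiplier making the Lagrangian strictly
convex are unique. -/
lemma IsIndefiniteMultiplier.unique_of_lt (hA0 : A0.IsSymm) (hA1 : A1.IsSymm)
    (hμ : ∀ v, v ≠ 0 → 0 < v ⬝ᵥ (A0 + μ • A1) *ᵥ v)
    (hx : qf1 A1 b1 c1 x = 0) (hy : qf1 A1 b1 c1 y = 0)
    (hxl : IsIndefiniteMultiplier A0 A1 b0 b1 x l)
    (hym : IsIndefiniteMultiplier A0 A1 b0 b1 y m) (hl : l < μ) (hm : m < μ) : x = y := by
  wlog hlm : l ≤ m generalizing x y l m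
  · exact (this hy hx hym hxl hm hl (le_of_not_ge hlm)).symm
  by_contra hne
  have hQs : ∀ s : ℝ, (A0 + s • A1).IsSymm := fun s => hA0.add (hA1.smul s)
  have hQ : ∀ (s : ℝ) (u v : Fin n → ℝ),
      u ⬝ᵥ (A0 + s • A1) *ᵥ v = u ⬝ᵥ A0 *ᵥ v + s * (u ⬝ᵥ A1 *ᵥ v) := by
    intro s u v
    simp [add_mulVec, smul_mulVec]
  obtain ⟨d, rfl⟩ : ∃ d, y = x + d := ⟨y - x, by simp⟩
  have hd : d ≠ 0 := by rintro rfl; simp at hne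
  have hPD : (A0 + l • A1) *ᵥ d = (l - m) • (A1 *ᵥ (x + d) + b1) := by
    have h1 := hxl.stationary
    have h2 := hym.stationary
    ext i
    have h1 := congrFun h1 i
    have h2 := congrFun h2 i
    simp only [mulVec_add, add_mulVec, smul_mulVec, Pi.add_apply, Pi.smul_apply, smul_eq_mul,
      Pi.zero_apply] at *
    linarith
  have hRD : (A0 + m • A1) *ᵥ d = (l - m) • (A1 *ᵥ x + b1) := by
    have h1 := hxl.stationary
    have h2 := hym.stationary
    ext i
    have h1 := congrFun h1 i
    have h2 := congrFun h2 i
    simp only [mulVec_add, add_mulVec, smul_mulVec, Pi.add_apply, Pi.smul_apply, smul_eq_mul,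
      Pi.zero_apply] at *
    linarith
  have hgx : 2 * ((A1 *ᵥ x + b1) ⬝ᵥ d) = -(d ⬝ᵥ A1 *ᵥ d) := by
    have := qf1_add (b1 := b1) (c1 := c1) hA1 x d
    rw [hx, hy] at this
    linarith
  have hR : d ⬝ᵥ (A0 + m • A1) *ᵥ d = (m - l) * (d ⬝ᵥ A1 *ᵥ d) / 2 := by
    rw [hRD, dotProduct_smul, smul_eq_mul, dotProduct_comm]
    linear_combination (l - m) / 2 * hgx
  have hP : d ⬝ᵥ (A0 + l • A1) *ᵥ d = -((m - l) * (d ⬝ᵥ A1 *ᵥ d) / 2) := by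
    rw [hQ] at hR ⊢
    linear_combination hR
  have ha : 0 < d ⬝ᵥ A1 *ᵥ d := by
    have h := hμ d hd
    have h2 : d ⬝ᵥ (A0 + μ • A1) *ᵥ d = ((m - l) / 2 + (μ - m)) * (d ⬝ᵥ A1 *ᵥ d) := by
      rw [hQ] at hR ⊢
      linear_combination hR
    rw [h2] at h
    exact pos_of_mul_pos_right h (by linarith)
  rcases hlm.eq_or_lt with rfl | hlt
  · obtain ⟨v, hv⟩ := hxl.exists_neg
    rw [sub_self, zero_smul] at hPD
    have hne : (A1 *ᵥ x + b1) ⬝ᵥ d ≠ 0 := by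
      intro h0
      rw [h0] at hgx
      linarith
    obtain ⟨t, ht⟩ : ∃ t : ℝ, t * ((A1 *ᵥ x + b1) ⬝ᵥ d) = (A1 *ᵥ x + b1) ⬝ᵥ v :=
      ⟨(A1 *ᵥ x + b1) ⬝ᵥ v / ((A1 *ᵥ x + b1) ⬝ᵥ d), by field_simp⟩
    have hc := hxl.curvature (v - t • d) (by
      rw [dotProduct_sub, dotProduct_smul, smul_eq_mul, ht, sub_self])
    rw [mulVec_sub, mulVec_smul, hPD, smul_zero, sub_zero, sub_dotProduct, smul_dotProduct,
      (hQs l).dotProduct_mulVec_comm d v, hPD, dotProduct_zero, smul_zero, sub_zero] at hc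
    linarith
  · obtain ⟨v, hv⟩ := hym.exists_neg
    have hml : 0 < m - l := by linarith
    have hlm0 : l - m ≠ 0 := by linarith
    refine hv.not_ge (nonneg_of_nonneg_on_conjugate_hyperplanes (hQs l) (hQs m)
      (p := (m - l) * (d ⬝ᵥ A1 *ᵥ d) / 2) (k := (μ - m) / (m - l)) (by positivity)
      (div_nonneg (by linarith) hml.le) hR hP ?_ ?_ ?_ v)
    · intro w hw
      rw [hRD, dotProduct_smul, smul_eq_mul, dotProduct_comm] at hw
      exact hxl.curvature w ((mul_eq_zero.mp hw).resolve_left hlm0)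
    · intro w hw
      rw [hPD, dotProduct_smul, smul_eq_mul, dotProduct_comm] at hw
      exact hym.curvature w ((mul_eq_zero.mp hw).resolve_left hlm0)
    · intro w
      have hw : 0 ≤ w ⬝ᵥ (A0 + μ • A1) *ᵥ w := by
        by_cases h0 : w = 0
        · simp [h0]
        · exact (hμ w h0).le
      rw [hQ] at hw
      rw [hQ, hQ]
      refine hw.trans_eq ?_
      field_simp
      ring

/-- Boundary points with indefinite multipliers above a multiplier making the Lagrangian strictly
convex are unique. -/
lemma IsIndefiniteMultiplier.unique_of_gt (hA0 : A0.IsSymm) (hA1 : A1.IsSymm)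
    (hμ : ∀ v, v ≠ 0 → 0 < v ⬝ᵥ (A0 + μ • A1) *ᵥ v)
    (hx : qf1 A1 b1 c1 x = 0) (hy : qf1 A1 b1 c1 y = 0)
    (hxl : IsIndefiniteMultiplier A0 A1 b0 b1 x l)
    (hym : IsIndefiniteMultiplier A0 A1 b0 b1 y m) (hl : μ < l) (hm : μ < m) : x = y := by
  have hq : ∀ z, qf1 (-A1) (-b1) (-c1) z = -qf1 A1 b1 c1 z := by
    intro z
    simp only [qf1, neg_mulVec, dotProduct_neg, neg_dotProduct]
    ring
  refine unique_of_lt (c1 := -c1) (μ := -μ) hA0 hA1.neg (by simpa using hμ) ?_ ?_ hxl.neg hym.neg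
    (neg_lt_neg hl) (neg_lt_neg hm)
  · rw [hq, hx, neg_zero]
  · rw [hq, hy, neg_zero]

/-- An indefinite multiplier `l` is separated from `μ` by a direction along which `(l - μ) A1` is
negative. -/
lemma IsIndefiniteMultiplier.exists_mul_neg
    (hμ : ∀ v, v ≠ 0 → 0 < v ⬝ᵥ (A0 + μ • A1) *ᵥ v)
    (hxl : IsIndefiniteMultiplier A0 A1 b0 b1 x l) :
    ∃ v, (l - μ) * (v ⬝ᵥ A1 *ᵥ v) < 0 := by
  obtain ⟨v, hv⟩ := hxl.exists_neg
  have hv0 : v ≠ 0 := by rintro rfl; simp at hv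
  have h := hμ v hv0
  simp only [add_mulVec, smul_mulVec, dotProduct_add, dotProduct_smul, smul_eq_mul] at h hv
  exact ⟨v, by linarith⟩

end QuadraticForms

theorem stmt15 {n : ℕ} (hn : 1 ≤ n)
    (A0 A1 : Matrix (Fin n) (Fin n) ℝ) (hA0 : A0.IsSymm) (hA1 : A1.IsSymm)
    (b0 b1 : Fin n → ℝ) (c1 : ℝ)
    (hjoint : ∃ μ1 : ℝ, (A0 + μ1 • A1).PosDef) :
    ((A1.PosSemidef ∨ (-A1).PosSemidef) →
       ∀ x y : Fin n → ℝ, IsLNGMinGTR A0 A1 b0 b1 c1 x →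
         IsLNGMinGTR A0 A1 b0 b1 c1 y → x = y) ∧
    ((∃ xb xt : Fin n → ℝ, xb ⬝ᵥ A1.mulVec xb < 0 ∧ 0 < xt ⬝ᵥ A1.mulVec xt) →
       ∃ a b : Fin n → ℝ, ∀ x : Fin n → ℝ,
         IsLNGMinGTR A0 A1 b0 b1 c1 x → x = a ∨ x = b) := by
  obtain ⟨μ, hpd⟩ := hjoint
  have hμ : ∀ v, v ≠ 0 → 0 < v ⬝ᵥ (A0 + μ • A1) *ᵥ v := fun v hv => by
    simpa using hpd.dotProduct_mulVec_pos hv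
  refine ⟨?_, fun _ => ?_⟩
  · rintro hdef x y hx hy
    obtain ⟨hx0, l, hl⟩ := hx.exists_isIndefiniteMultiplier hA0 hA1
    obtain ⟨hy0, m, hm⟩ := hy.exists_isIndefiniteMultiplier hA0 hA1
    obtain ⟨u, hu⟩ := hl.exists_mul_neg hμ
    obtain ⟨v, hv⟩ := hm.exists_mul_neg hμ
    rcases hdef with hA | hA
    · have hnn : ∀ w, 0 ≤ w ⬝ᵥ A1 *ᵥ w := fun w => by simpa using hA.dotProduct_mulVec_nonneg w
      exact hl.unique_of_lt hA0 hA1 hμ hx0 hy0 hm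
        (sub_neg.mp (neg_of_mul_neg_left hu (hnn u)))
        (sub_neg.mp (neg_of_mul_neg_left hv (hnn v)))
    · have hnn : ∀ w, w ⬝ᵥ A1 *ᵥ w ≤ 0 := fun w => by
        simpa [neg_mulVec] using hA.dotProduct_mulVec_nonneg w
      refine hl.unique_of_gt hA0 hA1 hμ hx0 hy0 hm ?_ ?_
      · by_contra! h
        exact hu.not_ge (mul_nonneg_of_nonpos_of_nonpos (by linarith) (hnn u))
      · by_contra! h
        exact hv.not_ge (mul_nonneg_of_nonpos_of_nonpos (by linarith) (hnn v))
  · let S (p : ℝ → Prop) : Set (Fin n → ℝ) :=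
      {x | qf1 A1 b1 c1 x = 0 ∧ ∃ l, IsIndefiniteMultiplier A0 A1 b0 b1 x l ∧ p l}
    have hlow : (S (· < μ)).Subsingleton := fun x ⟨hx, l, hl, hlμ⟩ y ⟨hy, m, hm, hmμ⟩ =>
      hl.unique_of_lt hA0 hA1 hμ hx hy hm hlμ hmμ
    have hupp : (S (μ < ·)).Subsingleton := fun x ⟨hx, l, hl, hlμ⟩ y ⟨hy, m, hm, hmμ⟩ =>
      hl.unique_of_gt hA0 hA1 hμ hx hy hm hlμ hmμ
    have hpt : ∀ T : Set (Fin n → ℝ), T.Subsingleton → ∃ a, ∀ x ∈ T, x = a := by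
      intro T hT
      rcases hT.eq_empty_or_singleton with rfl | ⟨a, rfl⟩
      · exact ⟨0, by simp⟩
      · exact ⟨a, by simp⟩
    obtain ⟨a, ha⟩ := hpt _ hlow
    obtain ⟨b, hb⟩ := hpt _ hupp
    refine ⟨a, b, fun x hx => ?_⟩
    obtain ⟨hx0, l, hl⟩ := hx.exists_isIndefiniteMultiplier hA0 hA1
    obtain ⟨v, hv⟩ := hl.exists_mul_neg hμ
    have hne : l ≠ μ := by rintro rfl; simp at hv
    rcases hne.lt_or_gt with h | h
    · exact .inl (ha x ⟨hx0, l, hl, h⟩)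
    · exact .inr (hb x ⟨hx0, l, hl, h⟩)
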